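/- Let F be a forest on a finite set I, let N₁ ⊆ N(F), and let N₁ = N'₁ ⊔ N''₁ be a partition of N₁ into two disjoint subsets. Then for every pair of forests F'₁ and F''₁ on I with F'₁ ⊆ F, N(F'₁) = N'₁, F''₁ ⊆ F, N(F''₁) = N''₁, there exists a unique forest F₁ on I such that F₁ ⊆ F, N(F₁) = N₁, F'₁ ⊆ F₁ and F''₁ ⊆ F₁. Consequently the map (F'₁, F''₁, F₁) ↦ (F'₁, F''₁) is a bijection from such triples to such pairs. -/

import Mathlib

/-- A forest on `I`: a partial order on `I` such that the set of elements below any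
element is totally ordered (a chain). -/
structure Forest (I : Type*) where
  le : I → I → Prop
  le_refl : ∀ i, le i i
  le_trans : ∀ ⦃i j k⦄, le i j → le j k → le i k
  le_antisymm : ∀ ⦃i j⦄, le i j → le j i → i = j
  downset_chain : ∀ ⦃i j k⦄, le j i → le k i → le j k ∨ le k j

namespace Forest

variable {I : Type*}

/-- Strict order associated to a forest. -/
def lt (F : Forest I) (i j : I) : Prop := F.le i j ∧ i ≠ j

/-- A root of a forest: a minimal element. -/
def IsRoot (F : Forest I) (r : I) : Prop := ∀ j, F.le j r → j = r

/-- A node of a forest: a vertex which is not a root, i.e. has some vertex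
strictly below it. -/
def IsNode (F : Forest I) (i : I) : Prop := ∃ j, F.lt j i

/-- The set `N(F)` of nodes of a forest. -/
def nodes (F : Forest I) : Set I := {i | F.IsNode i}

/-- `i` and `j` lie in the same block of the partition `π(F)` of `I` associated
to `F`, i.e. they lie above a common root. -/
def sameBlock (F : Forest I) (i j : I) : Prop :=
  ∃ r, F.IsRoot r ∧ F.le r i ∧ F.le r j

/-- The partial order `⊆` on forests: `F' ⊆ F` iff `≤_{F'}` implies `≤_F` and
each tree of `F'` is induced by `F` as a poset (elements of a common block of
`π(F')` that are comparable in `F` are comparable in `F'`). -/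
def Sub (F' F : Forest I) : Prop :=
  (∀ i j, F'.le i j → F.le i j) ∧
  (∀ i j, F'.sameBlock i j → F.le i j → F'.le i j)

/-- A tree is a forest with a (necessarily unique) minimal element lying below
every vertex. -/
def IsTree (T : Forest I) : Prop := ∃ r : I, ∀ i, T.le r i

end Forest

namespace Forest

section

variable {I : Type*}

theorem ext_le {F G : Forest I} (h : ∀ i j, F.le i j ↔ G.le i j) : F = G := by
  obtain ⟨l, _, _, _, _⟩ := F
  obtain ⟨m, _, _, _, _⟩ := G
  obtain rfl : l = m := funext₂ fun i j => propext (h i j)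
  rfl

theorem wellFounded_lt [Finite I] (F : Forest I) : WellFounded F.lt := by
  have : IsTrans I F.lt := ⟨fun i j k hij hjk => ⟨F.le_trans hij.1 hjk.1, by
    rintro rfl
    exact hij.2 (F.le_antisymm hij.1 hjk.1)⟩⟩
  have : Std.Irrefl F.lt := ⟨fun i h => h.2 rfl⟩
  exact Finite.wellFounded_of_trans_of_irrefl F.lt

theorem exists_root [Finite I] (F : Forest I) (i : I) : ∃ r, F.IsRoot r ∧ F.le r i := by
  induction i using F.wellFounded_lt.induction with
  | _ i ih =>
    by_cases h : F.IsRoot i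
    · exact ⟨i, h, F.le_refl i⟩
    · obtain ⟨j, hj, hne⟩ : ∃ j, F.le j i ∧ j ≠ i := by simpa [IsRoot] using h
      obtain ⟨r, hr, hrj⟩ := ih j ⟨hj, hne⟩
      exact ⟨r, hr, F.le_trans hrj hj⟩

/-- The root lying below a given vertex. -/
noncomputable def root [Finite I] (F : Forest I) (i : I) : I := (F.exists_root i).choose

variable [Finite I] {F G H : Forest I} {i j r : I}

theorem isRoot_root (F : Forest I) (i : I) : F.IsRoot (F.root i) :=
  (F.exists_root i).choose_spec.1

theorem root_le (F : Forest I) (i : I) : F.le (F.root i) i :=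
  (F.exists_root i).choose_spec.2

theorem root_eq (hr : F.IsRoot r) (h : F.le r i) : F.root i = r := by
  rcases F.downset_chain (F.root_le i) h with h | h
  · exact hr _ h
  · exact (F.isRoot_root i _ h).symm

theorem root_eq_of_le (h : F.le i j) : F.root i = F.root j :=
  (root_eq (F.isRoot_root i) (F.le_trans (F.root_le i) h)).symm

theorem sameBlock_iff : F.sameBlock i j ↔ F.root i = F.root j := by
  constructor
  · rintro ⟨r, hr, hi, hj⟩
    rw [root_eq hr hi, root_eq hr hj]
  · intro h
    exact ⟨F.root i, F.isRoot_root i, F.root_le i, h ▸ F.root_le j⟩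

theorem mem_nodes_iff : i ∈ F.nodes ↔ F.root i ≠ i := by
  constructor
  · rintro ⟨j, hj, hne⟩ h
    exact hne (F.isRoot_root i j (h.symm ▸ hj) |>.trans h)
  · intro h
    exact ⟨F.root i, F.root_le i, h⟩

theorem Sub.le_iff (h : G.Sub F) : G.le i j ↔ F.le i j ∧ G.root i = G.root j :=
  ⟨fun hij => ⟨h.1 _ _ hij, root_eq_of_le hij⟩, fun hij => h.2 _ _ (sameBlock_iff.2 hij.2) hij.1⟩

theorem Sub.root_root (h : G.Sub F) (i : I) : F.root (G.root i) = F.root i :=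
  root_eq_of_le (h.1 _ _ (G.root_le i))

theorem Sub.of_root_root (hG : G.Sub F) (hH : H.Sub F)
    (h : ∀ i, H.root (G.root i) = H.root i) : G.Sub H := by
  constructor
  · intro i j hij
    refine hH.le_iff.2 ⟨hG.1 _ _ hij, ?_⟩
    rw [← h i, root_eq_of_le hij, h j]
  · intro i j hb hij
    exact hG.2 _ _ hb (hH.1 _ _ hij)

theorem Sub.eq_of_root_eq (hG : G.Sub F) (hH : H.Sub F) (h : ∀ i, G.root i = H.root i) :
    G = H :=
  ext_le fun i j => by rw [hG.le_iff, hH.le_iff, h, h]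

/-- Idempotent maps decreasing for `F` are the root maps of the forests contained in `F`. -/
theorem exists_sub_root_eq (F : Forest I) (ρ : I → I) (hle : ∀ i, F.le (ρ i) i)
    (hρ : ∀ i, ρ (ρ i) = ρ i) : ∃ G : Forest I, G.Sub F ∧ ∀ i, G.root i = ρ i := by
  let G : Forest I :=
    { le := fun i j => F.le i j ∧ ρ i = ρ j
      le_refl := fun i => ⟨F.le_refl i, rfl⟩
      le_trans := fun i j k hij hjk => ⟨F.le_trans hij.1 hjk.1, hij.2.trans hjk.2⟩
      le_antisymm := fun i j hij hji => F.le_antisymm hij.1 hji.1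
      downset_chain := fun i j k hj hk => (F.downset_chain hj.1 hk.1).imp
        (fun h => ⟨h, hj.2.trans hk.2.symm⟩) (fun h => ⟨h, hk.2.trans hj.2.symm⟩) }
  have hroot (i : I) : G.root i = ρ i := by
    refine root_eq (fun j hj => F.le_antisymm hj.1 ?_) ⟨hle i, hρ i⟩
    rw [← hρ i, ← hj.2]
    exact hle j
  refine ⟨G, ⟨fun i j h => h.1, fun i j hb hij => ⟨hij, ?_⟩⟩, hroot⟩
  rw [← hroot, ← hroot, sameBlock_iff.1 hb]

/-- Iterating a decreasing map until it stabilizes. -/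
theorem exists_stable_iterate (F : Forest I) (g : I → I) (hg : ∀ i, F.le (g i) i) :
    ∃ ρ : I → I, (∀ i, F.le (ρ i) i) ∧ (∀ i, g (ρ i) = ρ i) ∧ (∀ i, ρ (g i) = ρ i) ∧
      ∀ i, g i = i → ρ i = i := by
  classical
  obtain ⟨ρ, hρ⟩ : ∃ ρ : I → I, ∀ i, ρ i = if g i = i then i else ρ (g i) := by
    refine ⟨F.wellFounded_lt.fix fun i f => if h : g i = i then i else f (g i) ⟨hg i, h⟩, ?_⟩
    intro i
    rw [WellFounded.fix_eq]
    split_ifs <;> rfl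
  have hfix (i : I) (h : g i = i) : ρ i = i := by rw [hρ, if_pos h]
  have hstep (i : I) : ρ (g i) = ρ i := by
    by_cases h : g i = i
    · rw [h]
    · rw [hρ i, if_neg h]
  have hind (i : I) : F.le (ρ i) i ∧ g (ρ i) = ρ i := by
    induction i using F.wellFounded_lt.induction with
    | _ i ih =>
      by_cases h : g i = i
      · rw [hfix i h]
        exact ⟨F.le_refl i, h⟩
      · rw [← hstep i]
        obtain ⟨h₁, h₂⟩ := ih (g i) ⟨hg i, h⟩
        exact ⟨F.le_trans h₁ (hg i), h₂⟩
  exact ⟨ρ, fun i => (hind i).1, fun i => (hind i).2, hstep, hfix⟩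

end

end Forest

/-- let `F` be a forest, `N₁ ⊆ N(F)` and `N₁ = N'₁ ⊔ N''₁` a
partition into disjoint subsets. For every pair of forests `F'₁ ⊆ F` with nodes
`N'₁` and `F''₁ ⊆ F` with nodes `N''₁`, there is a unique forest `F₁ ⊆ F` with
nodes `N₁` such that `F'₁ ⊆ F₁` and `F''₁ ⊆ F₁`; hence forgetting `F₁` is a
bijection from such triples to such pairs. -/
theorem unique_sup_with_nodes {I : Type*} [Finite I] (F : Forest I)
    (N₁ N'₁ N''₁ : Set I) (hN₁ : N₁ ⊆ F.nodes)
    (hdisj : N'₁ ∩ N''₁ = ∅) (hunion : N'₁ ∪ N''₁ = N₁)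
    (F'₁ F''₁ : Forest I) (h' : F'₁.Sub F) (hN' : F'₁.nodes = N'₁)
    (h'' : F''₁.Sub F) (hN'' : F''₁.nodes = N''₁) :
    ∃! F₁ : Forest I, F₁.Sub F ∧ F₁.nodes = N₁ ∧ F'₁.Sub F₁ ∧ F''₁.Sub F₁ := by
  classical
  subst hN' hN''
  let g : I → I := fun i => if i ∈ F''₁.nodes then F''₁.root i else F'₁.root i
  have hgle (i : I) : F.le (g i) i := by
    by_cases h : i ∈ F''₁.nodes
    · simpa only [g, if_pos h] using h''.1 _ _ (F''₁.root_le i)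
    · simpa only [g, if_neg h] using h'.1 _ _ (F'₁.root_le i)
  have hgnode (i : I) : i ∈ N₁ ↔ g i ≠ i := by
    rw [← hunion]
    by_cases h : i ∈ F''₁.nodes
    · simpa only [g, if_pos h, Set.mem_union, h, or_true, true_iff] using Forest.mem_nodes_iff.1 h
    · simpa only [g, if_neg h, Set.mem_union, h, or_false] using Forest.mem_nodes_iff
  obtain ⟨ρ, hρle, hgρ, hρg, hρfix⟩ := F.exists_stable_iterate g hgle
  obtain ⟨G, hGF, hG⟩ := F.exists_sub_root_eq ρ hρle fun i => hρfix _ (hgρ i)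
  have hGN : G.nodes = N₁ := by
    ext i
    rw [Forest.mem_nodes_iff, hG, hgnode]
    exact not_congr ⟨fun h => by rw [← h]; exact hgρ i, hρfix i⟩
  refine ⟨G, ⟨hGF, hGN, h'.of_root_root hGF fun i => ?_, h''.of_root_root hGF fun i => ?_⟩, ?_⟩
  · rw [hG, hG]
    by_cases h : i ∈ F''₁.nodes
    · have hi : i ∉ F'₁.nodes := fun hi => (hdisj ▸ ⟨hi, h⟩ : i ∈ (∅ : Set I))
      rw [not_not.1 (mt Forest.mem_nodes_iff.2 hi)]
    · simpa only [g, if_neg h] using hρg i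
  · rw [hG, hG]
    by_cases h : i ∈ F''₁.nodes
    · simpa only [g, if_pos h] using hρg i
    · rw [not_not.1 (mt Forest.mem_nodes_iff.2 h)]
  · rintro H ⟨hHF, hHN, hH', hH''⟩
    refine hHF.eq_of_root_eq hGF fun i => ?_
    have hHg (i : I) : H.root (g i) = H.root i := by
      by_cases h : i ∈ F''₁.nodes
      · simpa only [g, if_pos h] using hH''.root_root i
      · simpa only [g, if_neg h] using hH'.root_root i
    rw [hG]
    induction i using F.wellFounded_lt.induction with
    | _ i ih =>
      by_cases h : g i = i
      · rw [hρfix i h]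
        exact not_not.1 (mt Forest.mem_nodes_iff.2 (hHN ▸ mt (hgnode i).1 (not_not.2 h)))
      · rw [← hHg, ← hρg, ih (g i) ⟨hgle i, h⟩]
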